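/- arXiv:2208.06237 — 5 statements merged into one kernel-verified Lean document; each statement's English description precedes it below -/
import Mathlib

section
/- Let k ≥ 1 and r ≥ 1 be integers and let α₁,…,α_r ∈ ℝ^k, writing α_i = (α_i^1,…,α_i^k). The following are equivalent: (a) 0 ⪯ α_i in the lexicographic order for every i ∈ {1,…,r}; (b) there exists ε₀ > 0 such that for every ε ∈ (0,ε₀), every l ∈ {1,…,k} and every i ∈ {1,…,r}, one has α_i^1 + ε·α_i^2 + ε²·α_i^3 + ⋯ + ε^{l−1}·α_i^l ≥ 0. (This is the coordinate form of the Duality Theorem: setting x = (α_i^1)_{i} ∈ ℝ^r and w_j = (α_i^{j+1})_{i} ∈ ℝ^r for 1 ≤ j ≤ k−1, condition (b) says exactly that for each l ∈ {0,…,k−1} the point x + εw₁ + ε²w₂ + ⋯ + ε^l w_l lies in the nonnegative orthant ℝ₊^r for all sufficiently small ε > 0.) -/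
/-- If `a` vanishes below the index `m`, then `ε ^ m` factors out of its truncated sums. -/
theorem sum_Iic_pow_mul_eq_pow_mul_sum {k : ℕ} {a : Fin k → ℝ} {m : Fin k}
    (h0 : ∀ j < m, a j = 0) (l : Fin k) (ε : ℝ) :
    ∑ j ∈ Finset.Iic l, ε ^ (j : ℕ) * a j =
      ε ^ (m : ℕ) * ∑ j ∈ Finset.Iic l, ε ^ ((j : ℕ) - (m : ℕ)) * a j := by
  rw [Finset.mul_sum]
  refine Finset.sum_congr rfl fun j _ => ?_
  rcases lt_or_ge j m with hj | hj
  · simp [h0 j hj]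
  · rw [← mul_assoc, ← pow_add, Nat.add_sub_cancel' (Fin.le_def.mp hj)]

/-- If the first nonzero coordinate of `a` is positive, then every truncated sum is
nonnegative for small positive `ε`. -/
theorem eventually_sum_Iic_pow_mul_nonneg {k : ℕ} {a : Fin k → ℝ} {m : Fin k}
    (h0 : ∀ j < m, a j = 0) (hm : 0 < a m) (l : Fin k) :
    ∀ᶠ ε in nhdsWithin (0 : ℝ) (Set.Ioi 0),
      0 ≤ ∑ j ∈ Finset.Iic l, ε ^ (j : ℕ) * a j := by
  rcases lt_or_ge l m with hl | hl
  · refine Filter.Eventually.of_forall fun ε => (Finset.sum_eq_zero fun j hj => ?_).ge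
    rw [h0 j ((Finset.mem_Iic.mp hj).trans_lt hl), mul_zero]
  · have hcont : Continuous fun ε : ℝ =>
        ∑ j ∈ Finset.Iic l, ε ^ ((j : ℕ) - (m : ℕ)) * a j := by fun_prop
    have hzero : ∑ j ∈ Finset.Iic l, (0 : ℝ) ^ ((j : ℕ) - (m : ℕ)) * a j = a m := by
      rw [Finset.sum_eq_single_of_mem m (Finset.mem_Iic.mpr hl)]
      · simp
      · intro j _ hj
        rcases lt_or_gt_of_ne hj with hj | hj
        · rw [h0 j hj, mul_zero]
        · rw [zero_pow (Nat.sub_ne_zero_of_lt hj), zero_mul]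
    have hpos := hcont.continuousAt.eventually (lt_mem_nhds (hzero.symm ▸ hm))
    filter_upwards [nhdsWithin_le_nhds hpos, self_mem_nhdsWithin] with ε hε hε0
    rw [sum_Iic_pow_mul_eq_pow_mul_sum h0]
    exact mul_nonneg (pow_nonneg (le_of_lt hε0) _) (le_of_lt hε)

/-- A vector is lexicographically nonnegative iff each of its truncated sums is nonnegative
for small positive `ε`. -/
theorem zero_le_toLex_iff_eventually_sum_nonneg {k : ℕ} (a : Fin k → ℝ) :
    (0 : Lex (Fin k → ℝ)) ≤ toLex a ↔
      ∀ l : Fin k, ∀ᶠ ε in nhdsWithin (0 : ℝ) (Set.Ioi 0),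
        0 ≤ ∑ j ∈ Finset.Iic l, ε ^ (j : ℕ) * a j := by
  constructor
  · intro h l
    rcases h.eq_or_lt with h | ⟨m, h0, hm⟩
    · have ha : a = 0 := toLex.injective h.symm
      simp [ha]
    · exact eventually_sum_Iic_pow_mul_nonneg (fun j hj => (h0 j hj).symm) hm l
  · intro h
    by_contra hneg
    obtain ⟨m, h0, hm⟩ := not_le.mp hneg
    replace h0 : ∀ j < m, a j = 0 := h0
    replace hm : a m < 0 := hm
    obtain ⟨ε, hε, hε0⟩ := ((h m).and self_mem_nhdsWithin).exists
    rw [Finset.sum_eq_single_of_mem m (Finset.mem_Iic.mpr le_rfl)] at hε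
    · exact hε.not_gt (mul_neg_of_pos_of_neg (pow_pos hε0 _) hm)
    · intro j hj hjm
      rw [h0 j (lt_of_le_of_ne (Finset.mem_Iic.mp hj) hjm), mul_zero]

/-- **Coordinate form of the Duality Theorem.**
For vectors `α i ∈ ℝ^k`, `i ∈ Fin r`, lexicographic nonnegativity of every `α i` is
equivalent to the existence of `ε₀ > 0` such that for every `ε ∈ (0, ε₀)`, every
`l ∈ {1,…,k}` (encoded by `l : Fin k`, truncation length `l+1`) and every `i`, the
truncated sum `α i 0 + ε * α i 1 + ⋯ + ε^l * α i l` is nonnegative. -/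
theorem duality_coordinate_form (k r : ℕ) (hk : 1 ≤ k) (hr : 1 ≤ r)
    (α : Fin r → Fin k → ℝ) :
    (∀ i : Fin r, (0 : Lex (Fin k → ℝ)) ≤ toLex (α i)) ↔
      ∃ ε₀ > (0 : ℝ), ∀ ε ∈ Set.Ioo (0 : ℝ) ε₀, ∀ l : Fin k, ∀ i : Fin r,
        0 ≤ ∑ j ∈ Finset.Iic l, ε ^ (j : ℕ) * α i j := by
  simp only [zero_le_toLex_iff_eventually_sum_nonneg]
  rw [forall_comm]
  simp only [← Filter.eventually_all]
  exact mem_nhdsGT_iff_exists_Ioo_subset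
end

section
/- Let N ≥ 1 and k ≥ 0 be integers, let τ₁,…,τ_m ⊆ ℝ^N be closed convex sets, and let σ = τ₁ ∪ ⋯ ∪ τ_m. Then TC^k σ = TC^k τ₁ ∪ ⋯ ∪ TC^k τ_m; that is, a tuple (x; w₁,…,w_k) satisfies the nested approach conditions for σ if and only if it satisfies them for some single τ_i. (This is the content of the proposition that the tangent cone bundle of a cone complex is invariant under subdivision.) -/
/-- The nested approach predicate: `NestedApproach S x [w₁,…,w_r]` holds iff, recursively,
there is `ε₀ > 0` such that for every `ε ∈ (0, ε₀)`, `NestedApproach S (x + ε•w₁) [w₂,…,w_r]`,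
with base case `NestedApproach S x [] ↔ x ∈ S`. -/
def NestedApproach {N : ℕ} (S : Set (Fin N → ℝ)) :
    (Fin N → ℝ) → List (Fin N → ℝ) → Prop
  | x, [] => x ∈ S
  | x, w :: ws => ∃ ε₀ > (0 : ℝ), ∀ ε ∈ Set.Ioo (0 : ℝ) ε₀,
      NestedApproach S (x + ε • w) ws

/-- The tangent cone of order `k` of a subset `S ⊆ ℝ^N`: all tuples `(x; w₁,…,w_k)` such
that for every `j ∈ {0,…,k}` the nested approach predicate holds for the first `j`
direction vectors. -/
def tangentCone {N : ℕ} (k : ℕ) (S : Set (Fin N → ℝ)) :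
    Set ((Fin N → ℝ) × (Fin k → (Fin N → ℝ))) :=
  {p | ∀ j ≤ k, NestedApproach S p.1 ((List.ofFn p.2).take j)}

open Filter Topology

namespace NestedApproach

variable {N : ℕ} {S T : Set (Fin N → ℝ)} {x w : Fin N → ℝ} {l l' ws : List (Fin N → ℝ)}

theorem cons_iff_eventually :
    NestedApproach S x (w :: ws) ↔ ∀ᶠ ε in 𝓝[>] (0 : ℝ), NestedApproach S (x + ε • w) ws :=
  mem_nhdsGT_iff_exists_Ioo_subset.symm

theorem mono (hST : S ⊆ T) (h : NestedApproach S x l) : NestedApproach T x l := by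
  induction l generalizing x with
  | nil => exact hST h
  | cons w ws ih =>
    rw [cons_iff_eventually] at h ⊢
    exact h.mono fun _ => ih

theorem mem_of_isClosed (hS : IsClosed S) (h : NestedApproach S x l) : x ∈ S := by
  induction l generalizing x with
  | nil => exact h
  | cons w ws ih =>
    rw [cons_iff_eventually] at h
    have hlim : Tendsto (fun ε : ℝ => x + ε • w) (𝓝[>] 0) (𝓝 x) := by
      have hcont : Continuous fun ε : ℝ => x + ε • w := by fun_prop
      simpa using (hcont.tendsto 0).mono_left nhdsWithin_le_nhds
    exact hS.mem_of_tendsto hlim (h.mono fun _ => ih)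

theorem of_append (hS : IsClosed S) (h : NestedApproach S x (l ++ l')) :
    NestedApproach S x l := by
  induction l generalizing x with
  | nil => exact h.mem_of_isClosed hS
  | cons w ws ih =>
    rw [List.cons_append, cons_iff_eventually] at h
    exact cons_iff_eventually.2 (h.mono fun _ => ih)

theorem take (hS : IsClosed S) (h : NestedApproach S x l) (j : ℕ) :
    NestedApproach S x (l.take j) :=
  of_append (l' := l.drop j) hS (by rwa [List.take_append_drop])

theorem convex_setOf (hS : Convex ℝ S) (l : List (Fin N → ℝ)) :
    Convex ℝ {x | NestedApproach S x l} := by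
  induction l with
  | nil => exact hS
  | cons w ws ih =>
    intro x hx y hy a b ha hb hab
    rw [Set.mem_ofPred_eq, cons_iff_eventually] at hx hy ⊢
    filter_upwards [hx, hy] with ε hxε hyε
    have heq : a • x + b • y + ε • w = a • (x + ε • w) + b • (y + ε • w) := by
      rw [smul_add, smul_add, add_add_add_comm, ← add_smul, hab, one_smul]
    rw [heq]
    exact ih hxε hyε ha hb hab

theorem cons_of_frequently (hS : Convex ℝ S)
    (h : ∃ᶠ ε in 𝓝[>] (0 : ℝ), NestedApproach S (x + ε • w) ws) :
    NestedApproach S x (w :: ws) := by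
  have hconv : Convex ℝ {ε : ℝ | NestedApproach S (x + ε • w) ws} := by
    intro s hs t ht a b ha hb hab
    have heq : x + (a • s + b • t) • w = a • (x + s • w) + b • (x + t • w) := by
      rw [smul_add, smul_add, add_add_add_comm, ← add_smul, hab, one_smul, add_smul,
        smul_assoc, smul_assoc]
    rw [Set.mem_ofPred_eq, heq]
    exact convex_setOf hS ws hs ht ha hb hab
  obtain ⟨δ, hδ, hδpos⟩ := (h.and_eventually self_mem_nhdsWithin).exists
  refine ⟨δ, hδpos, fun ε hε => ?_⟩
  obtain ⟨η, hη, hηε⟩ := (h.and_eventually (Ioo_mem_nhdsGT hε.1)).exists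
  exact hconv.ordConnected.out hη hδ ⟨hηε.2.le, hε.2.le⟩

theorem iUnion_iff {ι : Type*} [Finite ι] {τ : ι → Set (Fin N → ℝ)}
    (hτ : ∀ i, Convex ℝ (τ i)) :
    NestedApproach (⋃ i, τ i) x l ↔ ∃ i, NestedApproach (τ i) x l := by
  refine ⟨fun h => ?_, fun ⟨i, h⟩ => h.mono (Set.subset_iUnion τ i)⟩
  induction l generalizing x with
  | nil => exact Set.mem_iUnion.1 h
  | cons w ws ih =>
    rw [cons_iff_eventually] at h
    by_contra! hnot
    have hall : ∀ᶠ ε in 𝓝[>] (0 : ℝ), ∀ i, ¬ NestedApproach (τ i) (x + ε • w) ws :=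
      eventually_all.2 fun i =>
        not_frequently.1 fun hfreq => hnot i (cons_of_frequently (hτ i) hfreq)
    obtain ⟨ε, hε, hεnot⟩ := (h.and hall).exists
    obtain ⟨i, hi⟩ := ih hε
    exact hεnot i hi

end NestedApproach

/-- **Invariance of tangent cone bundles under subdivision.** If `σ` is a finite union of
closed convex sets `τ₁,…,τ_m ⊆ ℝ^N`, then the order-`k` tangent cone of `σ` is the union
of the order-`k` tangent cones of the `τᵢ`. -/
theorem tangentCone_union (N : ℕ) (hN : 1 ≤ N) (k m : ℕ)
    (τ : Fin m → Set (Fin N → ℝ))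
    (hclosed : ∀ i, IsClosed (τ i)) (hconvex : ∀ i, Convex ℝ (τ i)) :
    tangentCone k (⋃ i, τ i) = ⋃ i, tangentCone k (τ i) := by
  ext ⟨x, w⟩
  simp only [tangentCone, Set.mem_iUnion, Set.mem_ofPred_eq]
  constructor
  · intro h
    obtain ⟨i, hi⟩ := (NestedApproach.iUnion_iff hconvex).1 (h k le_rfl)
    rw [List.take_of_length_le (List.length_ofFn).le] at hi
    exact ⟨i, fun j _ => hi.take (hclosed i) j⟩
  · rintro ⟨i, hi⟩ j hj
    exact (hi j hj).mono (Set.subset_iUnion τ i)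
end

section
/- Let A ⊆ ℝ^r be a finite nonempty set, let k ≥ 0, and let x, w₁,…,w_k ∈ ℝ^r. Let β₀ ∈ A be a point at which the map β ↦ (⟨x,β⟩, ⟨w₁,β⟩, …, ⟨w_k,β⟩) ∈ ℝ^{k+1} attains its lexicographic minimum over A. Then there exists ε₀ > 0 such that for every ε ∈ (0, ε₀): ⟨x + εw₁ + ε²w₂ + ⋯ + ε^k w_k, β₀⟩ = min_{β∈A} ⟨x + εw₁ + ε²w₂ + ⋯ + ε^k w_k, β⟩. (This is the key step in the analytic description of quasi-monomial valuations: along the curve ε ↦ x + εw₁ + ⋯ + ε^k w_k the minimum of the linear forms ⟨·,β⟩, β ∈ A, is eventually achieved by any lexicographic minimizer β₀.) -/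
open Filter Topology in
/-- If `c` vanishes before index `i` and `c i > 0`, the polynomial with coefficients `c` is
nonnegative at all sufficiently small positive reals. -/
theorem eventually_sum_pow_mul_nonneg {n : ℕ} (c : Fin n → ℝ) (i : Fin n)
    (hlt : ∀ j < i, c j = 0) (hi : 0 < c i) :
    ∀ᶠ ε : ℝ in 𝓝[>] 0, 0 ≤ ∑ j : Fin n, ε ^ (j : ℕ) * c j := by
  have hcont : Continuous fun ε : ℝ => ∑ j : Fin n, ε ^ ((j : ℕ) - i) * c j := by fun_prop
  have h0 : ∑ j : Fin n, (0 : ℝ) ^ ((j : ℕ) - i) * c j = c i := by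
    rw [Finset.sum_eq_single i]
    · simp
    · intro j _ hj
      rcases lt_or_gt_of_ne hj with h | h
      · simp [hlt j h]
      · rw [zero_pow (Nat.sub_ne_zero_of_lt h), zero_mul]
    · simp
  have hev : ∀ᶠ ε : ℝ in 𝓝 0, 0 < ∑ j : Fin n, ε ^ ((j : ℕ) - i) * c j :=
    hcont.continuousAt.eventually_const_lt (by simpa only [h0] using hi)
  filter_upwards [hev.filter_mono nhdsWithin_le_nhds, self_mem_nhdsWithin] with ε hε hpos
  have hfac : ∑ j : Fin n, ε ^ (j : ℕ) * c j = ε ^ (i : ℕ) * ∑ j : Fin n, ε ^ ((j : ℕ) - i) * c j := by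
    rw [Finset.mul_sum]
    refine Finset.sum_congr rfl fun j _ => ?_
    rcases lt_or_ge j i with h | h
    · simp [hlt j h]
    · rw [← mul_assoc, ← pow_add, Nat.add_sub_cancel' h]
  rw [hfac]
  exact mul_nonneg (pow_nonneg (le_of_lt hpos) _) hε.le

open Filter Topology in
/-- The lexicographic order on coefficient vectors implies the order of the values of the
corresponding polynomials at all sufficiently small positive reals. -/
theorem eventually_sum_pow_mul_le_of_toLex_le {n : ℕ} {a b : Fin n → ℝ}
    (h : toLex a ≤ toLex b) :
    ∀ᶠ ε : ℝ in 𝓝[>] 0, ∑ j : Fin n, ε ^ (j : ℕ) * a j ≤ ∑ j : Fin n, ε ^ (j : ℕ) * b j := by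
  rcases h.lt_or_eq with ⟨i, hlt, hi⟩ | h
  · filter_upwards [eventually_sum_pow_mul_nonneg (fun j => b j - a j) i
      (fun j hj => sub_eq_zero.2 (hlt j hj).symm) (sub_pos.2 hi)] with ε hε
    simpa only [mul_sub, Finset.sum_sub_distrib, sub_nonneg] using hε
  · rw [toLex_inj.1 h]
    simp

/-- The pairing of a vector with a point of the curve `x + ε w₁ + ⋯ + ε^k w_k`, expanded in
powers of `ε`. -/
theorem sum_curve_mul_eq_sum_pow_mul {r k : ℕ} (x : Fin r → ℝ) (w : Fin k → (Fin r → ℝ))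
    (β : Fin r → ℝ) (ε : ℝ) :
    ∑ i : Fin r, (x i + ∑ j : Fin k, ε ^ ((j : ℕ) + 1) * w j i) * β i =
      ∑ j : Fin (k + 1), ε ^ (j : ℕ) *
        ∑ i : Fin r, (Fin.cons x w : Fin (k + 1) → (Fin r → ℝ)) j i * β i := by
  simp only [Fin.sum_univ_succ, Fin.cons_zero, Fin.cons_succ, Fin.val_zero, Fin.val_succ,
    pow_zero, one_mul, add_mul, Finset.sum_add_distrib, Finset.sum_mul, Finset.mul_sum, mul_assoc]
  rw [Finset.sum_comm]

/-- **Eventual minimality along a curve of a lexicographic minimizer.**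
Let `A ⊆ ℝ^r` be a finite nonempty set, `x, w₁,…,w_k ∈ ℝ^r`, and let `β₀ ∈ A` be a point
at which `β ↦ (⟨x,β⟩, ⟨w₁,β⟩, …, ⟨w_k,β⟩) ∈ ℝ^{k+1}` attains its lexicographic minimum
over `A`. Then for all sufficiently small `ε > 0`, the linear form
`⟨x + εw₁ + ε²w₂ + ⋯ + ε^k w_k, ·⟩` attains its minimum over `A` at `β₀`. -/
theorem lex_minimizer_eventually_min (r k : ℕ) (hr : 1 ≤ r)
    (A : Finset (Fin r → ℝ)) (hA : A.Nonempty)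
    (x : Fin r → ℝ) (w : Fin k → (Fin r → ℝ))
    (β₀ : Fin r → ℝ) (hβ₀ : β₀ ∈ A)
    (hmin : ∀ β ∈ A,
      toLex (fun j : Fin (k + 1) => ∑ i : Fin r, (Fin.cons x w : Fin (k + 1) → (Fin r → ℝ)) j i * β₀ i) ≤
        toLex (fun j : Fin (k + 1) => ∑ i : Fin r, (Fin.cons x w : Fin (k + 1) → (Fin r → ℝ)) j i * β i)) :
    ∃ ε₀ > (0 : ℝ), ∀ ε ∈ Set.Ioo (0 : ℝ) ε₀,
      (∑ i : Fin r, (x i + ∑ j : Fin k, ε ^ ((j : ℕ) + 1) * w j i) * β₀ i) =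
        A.inf' hA (fun β => ∑ i : Fin r, (x i + ∑ j : Fin k, ε ^ ((j : ℕ) + 1) * w j i) * β i) := by
  have hev : ∀ᶠ ε : ℝ in nhdsWithin 0 (Set.Ioi 0), ∀ β ∈ A,
      ∑ i : Fin r, (x i + ∑ j : Fin k, ε ^ ((j : ℕ) + 1) * w j i) * β₀ i ≤
        ∑ i : Fin r, (x i + ∑ j : Fin k, ε ^ ((j : ℕ) + 1) * w j i) * β i := by
    rw [Filter.eventually_all_finset]
    intro β hβ
    simpa only [sum_curve_mul_eq_sum_pow_mul] using
      eventually_sum_pow_mul_le_of_toLex_le (hmin β hβ)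
  obtain ⟨ε₀, hε₀, hsub⟩ := mem_nhdsGT_iff_exists_Ioo_subset.1 hev
  exact ⟨ε₀, hε₀, fun ε hε =>
    le_antisymm (Finset.le_inf' _ _ (hsub hε)) (Finset.inf'_le _ hβ₀)⟩
end

section
/- Let d ≥ 1, let (C_n)_{n∈ℕ} be a sequence of compact convex subsets of ℝ^d each with nonempty interior, and let C ⊆ ℝ^d be a compact convex set with nonempty interior. If for every continuous function f : ℝ^d → ℝ with compact support one has ∫_{C_n} f(x) dx → ∫_C f(x) dx as n → ∞, then d_H(C_n, C) → 0 as n → ∞. -/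
open MeasureTheory Filter

section WeakConvergence

variable {E : Type*} [NormedAddCommGroup E] [InnerProductSpace ℝ E]

/-- If every point of a ball is within distance `δ` of a closed convex set, then the concentric
ball of radius smaller by `δ` is contained in the set. -/
theorem Convex.ball_sub_subset_of_forall_exists_dist_lt [FiniteDimensional ℝ E] {K : Set E}
    (hK : Convex ℝ K) (hKc : IsClosed K) (hKn : K.Nonempty) {x : E} {r δ : ℝ} (hδ : 0 < δ)
    (h : ∀ y ∈ Metric.ball x r, ∃ c ∈ K, dist y c < δ) : Metric.ball x (r - δ) ⊆ K := by
  intro z hz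
  by_contra hzK
  obtain ⟨p, hp, hpz⟩ := exists_norm_eq_iInf_of_complete_convex hKn hKc.isComplete hK z
  rw [norm_eq_iInf_iff_real_inner_le_zero hK hp] at hpz
  have hne : z - p ≠ 0 := fun h0 => hzK (by rwa [sub_eq_zero.1 h0])
  have hn : 0 < ‖z - p‖ := norm_pos_iff.2 hne
  set u : E := ‖z - p‖⁻¹ • (z - p) with hu
  have hu1 : ‖u‖ = 1 := by rw [hu, norm_smul, norm_inv, norm_norm, inv_mul_cancel₀ hn.ne']
  obtain ⟨c, hc, hcd⟩ := h (z + δ • u) (by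
    rw [Metric.mem_ball] at hz ⊢
    have h1 : dist (z + δ • u) z = δ := by
      rw [dist_eq_norm, add_sub_cancel_left, norm_smul, hu1, mul_one, Real.norm_of_nonneg hδ.le]
    linarith [dist_triangle (z + δ • u) z x])
  have h1 : 0 ≤ inner ℝ u (z - c) := by
    rw [hu, real_inner_smul_left]
    refine mul_nonneg (inv_nonneg.2 hn.le) ?_
    have h2 := hpz c hc
    have h3 : z - c = (z - p) - (c - p) := by abel
    rw [h3, inner_sub_right]
    linarith [real_inner_self_nonneg (x := z - p)]
  have h2 : inner ℝ u (z + δ • u - c) = inner ℝ u (z - c) + δ := by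
    rw [add_sub_right_comm, inner_add_right, real_inner_smul_right, real_inner_self_eq_norm_sq,
      hu1]
    ring
  have h3 := real_inner_le_norm u (z + δ • u - c)
  rw [hu1, one_mul, ← dist_eq_norm] at h3
  linarith

/-- A convex set containing a ball `B(x, r)` and a point `y` contains the image of the ball under
a contraction towards `y`. -/
theorem Convex.ball_subset_of_mem_of_ball_subset {K : Set E} (hK : Convex ℝ K) {x y : E} {r t : ℝ}
    (hxr : Metric.ball x r ⊆ K) (hy : y ∈ K) (ht : 0 < t) (ht1 : t ≤ 1) :
    Metric.ball (y + t • (x - y)) (t * r) ⊆ K := by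
  intro z hz
  have hw : y + t⁻¹ • (z - y) ∈ Metric.ball x r := by
    have h1 : y + t⁻¹ • (z - y) - x = t⁻¹ • (z - (y + t • (x - y))) := by
      rw [← sub_sub z, smul_sub _ (z - y), smul_smul, inv_mul_cancel₀ ht.ne', one_smul]
      abel
    rw [Metric.mem_ball, dist_eq_norm] at hz ⊢
    rw [h1, norm_smul, norm_inv, Real.norm_of_nonneg ht.le, inv_mul_lt_iff₀ ht]
    exact hz
  have h2 := hK.add_smul_sub_mem hy (hxr hw) ⟨ht.le, ht1⟩
  rwa [add_sub_cancel_left, smul_smul, mul_inv_cancel₀ ht.ne', one_smul,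
    add_sub_cancel] at h2

variable [FiniteDimensional ℝ E] [MeasurableSpace E] [BorelSpace E]

/-- If the integrals over `C n` converge to those over `D`, then `C n` eventually meets every ball
centred in the closure of the interior of `D`. -/
theorem eventually_exists_mem_dist_lt (μ : Measure E) [μ.IsAddHaarMeasure] {C : ℕ → Set E}
    {D : Set E}
    (hweak : ∀ f : E → ℝ, Continuous f → HasCompactSupport f →
      Tendsto (fun n => ∫ x in C n, f x ∂μ) atTop (nhds (∫ x in D, f x ∂μ)))
    {x : E} (hx : x ∈ closure (interior D)) {ρ : ℝ} (hρ : 0 < ρ) :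
    ∀ᶠ n in atTop, ∃ c ∈ C n, dist x c < ρ := by
  set f : E → ℝ := fun z => max 0 (ρ - dist z x) with hf
  have hfc : Continuous f := by fun_prop
  have hfz : ∀ z, ρ ≤ dist z x → f z = 0 := fun z hz => max_eq_left (by linarith)
  have hfs : HasCompactSupport f :=
    HasCompactSupport.intro (isCompact_closedBall x ρ) fun z hz => hfz z (by
      rw [Metric.mem_closedBall, not_le] at hz; exact hz.le)
  have hpos : 0 < ∫ z in D, f z ∂μ := by
    rw [integral_pos_iff_support_of_nonneg (f := f)
      (fun z => le_max_left _ _) (hfc.integrable_of_hasCompactSupport hfs).integrableOn]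
    have hne : (interior D ∩ Metric.ball x ρ).Nonempty := by
      rw [Set.inter_comm]
      exact mem_closure_iff_nhds.1 hx _ (Metric.ball_mem_nhds x hρ)
    refine lt_of_lt_of_le ((isOpen_interior.inter Metric.isOpen_ball).measure_pos μ hne) ?_
    rw [Measure.restrict_apply (hfc.isOpen_support.measurableSet)]
    refine measure_mono fun z hz => ⟨?_, interior_subset hz.1⟩
    have : 0 < ρ - dist z x := by have := Metric.mem_ball.1 hz.2; linarith
    exact (lt_max_of_lt_right this).ne'
  filter_upwards [(hweak f hfc hfs).eventually (lt_mem_nhds hpos)] with n hn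
  by_contra! h
  refine hn.ne' (setIntegral_eq_zero_of_forall_eq_zero fun z hz => hfz z ?_)
  rw [dist_comm]
  exact h z hz

/-- A compact `D` contained in the closure of its interior is eventually contained in every
neighbourhood of `C n`. -/
theorem eventually_forall_exists_mem_dist_lt (μ : Measure E) [μ.IsAddHaarMeasure]
    {C : ℕ → Set E} {D : Set E} (hD : IsCompact D)
    (hDint : D ⊆ closure (interior D))
    (hweak : ∀ f : E → ℝ, Continuous f → HasCompactSupport f →
      Tendsto (fun n => ∫ x in C n, f x ∂μ) atTop (nhds (∫ x in D, f x ∂μ)))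
    {ε : ℝ} (hε : 0 < ε) :
    ∀ᶠ n in atTop, ∀ x ∈ D, ∃ c ∈ C n, dist x c < ε := by
  obtain ⟨t, htD, ht, hcov⟩ := hD.finite_cover_balls (half_pos hε)
  have := (eventually_all_finite ht).2 fun x hx =>
    eventually_exists_mem_dist_lt μ hweak (hDint (htD hx)) (half_pos hε)
  filter_upwards [this] with n hn x hx
  obtain ⟨y, hy, hxy⟩ := Set.mem_iUnion₂.1 (hcov hx)
  obtain ⟨c, hc, hyc⟩ := hn y hy
  have h := Metric.mem_ball.1 hxy
  exact ⟨c, hc, by linarith [dist_triangle x y c]⟩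

/-- If the integrals over the convex sets `C n` converge to those over the compact set `D`, and the
`C n` eventually contain a fixed ball centred in `D`, then they are eventually contained in every
neighbourhood of `D`. -/
theorem eventually_forall_infDist_le (μ : Measure E) [μ.IsAddHaarMeasure]
    {C : ℕ → Set E} {D : Set E} (hCconv : ∀ n, Convex ℝ (C n))
    (hD : IsCompact D)
    (hweak : ∀ f : E → ℝ, Continuous f → HasCompactSupport f →
      Tendsto (fun n => ∫ x in C n, f x ∂μ) atTop (nhds (∫ x in D, f x ∂μ)))
    {x : E} (hx : x ∈ D) {r : ℝ} (hr : 0 < r) (hball : ∀ᶠ n in atTop, Metric.ball x r ⊆ C n)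
    {ε : ℝ} (hε : 0 < ε) :
    ∀ᶠ n in atTop, ∀ y ∈ C n, Metric.infDist y D ≤ ε := by
  have hDn : D.Nonempty := ⟨x, hx⟩
  have hcont : Continuous fun z => Metric.infDist z D := Metric.continuous_infDist_pt D
  obtain ⟨R, hR0, hR⟩ : ∃ R, 0 < R ∧ ∀ z, Metric.infDist z D ≤ 2 * ε → dist z x ≤ R := by
    refine ⟨Metric.diam D + 2 * ε, by linarith [Metric.diam_nonneg (s := D)], fun z hz => ?_⟩
    obtain ⟨w, hw, hzw⟩ := hD.exists_infDist_eq_dist hDn z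
    linarith [dist_triangle z w x, Metric.dist_le_diam_of_mem hD.isBounded hw hx]
  set f : E → ℝ := fun z => max 0 (1 - |Metric.infDist z D - ε| / ε) with hf
  have hfc : Continuous f := by fun_prop
  have hf0 : ∀ z, 0 ≤ f z := fun z => le_max_left _ _
  have hfs : HasCompactSupport f :=
    HasCompactSupport.intro (isCompact_closedBall x R) fun z hz => by
      have h1 : 2 * ε < Metric.infDist z D := by
        by_contra! h
        exact hz (hR z h)
      refine max_eq_left ?_
      rw [sub_nonpos, le_div_iff₀ hε]
      linarith [le_abs_self (Metric.infDist z D - ε)]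
  have hfi : Integrable f μ := hfc.integrable_of_hasCompactSupport hfs
  have hfD : ∫ z in D, f z ∂μ = 0 := by
    refine setIntegral_eq_zero_of_forall_eq_zero fun z hz => max_eq_left ?_
    rw [Metric.infDist_zero_of_mem hz, zero_sub, abs_neg, abs_of_pos hε, div_self hε.ne', sub_self]
  set t : ℝ := min 1 (ε / (2 * (R + r))) with ht
  have ht0 : 0 < t := lt_min one_pos (by positivity)
  have ht1 : t ≤ 1 := min_le_left _ _
  have htR : t * (R + r) ≤ ε / 2 := by
    have h1 : t ≤ ε / (2 * (R + r)) := min_le_right _ _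
    rw [le_div_iff₀ (by positivity)] at h1
    linarith
  set v : ℝ := μ.real (Metric.ball (0 : E) (t * r)) with hv
  have hv0 : 0 < v := ENNReal.toReal_pos
    (Metric.measure_ball_pos μ _ (mul_pos ht0 hr)).ne' measure_ball_lt_top.ne
  have hlim := hweak f hfc hfs
  rw [hfD] at hlim
  filter_upwards [hlim.eventually (gt_mem_nhds (half_pos hv0)), hball] with n hn hxn y hy
  by_contra! hyε
  obtain ⟨y', hy', hy'ε⟩ : ∃ y' ∈ C n, Metric.infDist y' D = ε := by
    have hpre := (hCconv n).isPreconnected.intermediate_value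
      (hxn (Metric.mem_ball_self hr)) hy hcont.continuousOn
    exact hpre ⟨by rw [Metric.infDist_zero_of_mem hx]; exact hε.le, hyε.le⟩
  set c : E := y' + t • (x - y') with hc
  have hsub : Metric.ball c (t * r) ⊆ C n :=
    (hCconv n).ball_subset_of_mem_of_ball_subset hxn hy' ht0 ht1
  have hhalf : ∀ z ∈ Metric.ball c (t * r), 1 / 2 ≤ f z := by
    intro z hz
    have h1 : dist c y' ≤ t * R := by
      rw [hc, dist_eq_norm, add_sub_cancel_left, norm_smul, Real.norm_of_nonneg ht0.le,
        ← dist_eq_norm, dist_comm]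
      exact mul_le_mul_of_nonneg_left (hR y' (by linarith)) ht0.le
    have h2 : dist z y' ≤ ε / 2 := by
      linarith [dist_triangle z c y', Metric.mem_ball.1 hz]
    have h3 : |Metric.infDist z D - ε| ≤ ε / 2 := by
      rw [abs_le, ← hy'ε]
      have h4 := Metric.infDist_le_infDist_add_dist (s := D) (x := z) (y := y')
      have h5 := Metric.infDist_le_infDist_add_dist (s := D) (x := y') (y := z)
      rw [dist_comm] at h5
      constructor <;> linarith
    refine le_max_of_le_right ?_
    have h4 : |Metric.infDist z D - ε| / ε ≤ 1 / 2 := by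
      rw [div_le_iff₀ hε]; linarith
    linarith
  have hlow : v / 2 ≤ ∫ z in C n, f z ∂μ := by
    have h1 : ∫ z in Metric.ball c (t * r), f z ∂μ ≤ ∫ z in C n, f z ∂μ :=
      setIntegral_mono_set hfi.integrableOn (ae_of_all _ hf0) (LE.le.eventuallyLE hsub)
    have h2 := setIntegral_ge_of_const_le_real measurableSet_ball measure_ball_lt_top.ne hhalf
      hfi.integrableOn
    have h3 : μ.real (Metric.ball c (t * r)) = v := by
      rw [hv, Measure.real, Measure.real, Measure.addHaar_ball_center]
    rw [h3] at h2
    linarith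
  linarith

end WeakConvergence

/-- **Weak convergence of convex bodies implies Hausdorff convergence.**
If `(C n)` is a sequence of compact convex subsets of `ℝ^d` with nonempty interior,
`D` is a compact convex set with nonempty interior, and for every continuous compactly
supported `f : ℝ^d → ℝ` the integrals `∫_{C n} f` converge to `∫_D f`, then `C n → D` in
Hausdorff distance. -/
theorem integral_tendsto_hausdorff_tendsto (d : ℕ) (hd : 1 ≤ d)
    (C : ℕ → Set (EuclideanSpace ℝ (Fin d))) (D : Set (EuclideanSpace ℝ (Fin d)))
    (hCcpt : ∀ n, IsCompact (C n)) (hCconv : ∀ n, Convex ℝ (C n))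
    (hCint : ∀ n, (interior (C n)).Nonempty)
    (hDcpt : IsCompact D) (hDconv : Convex ℝ D) (hDint : (interior D).Nonempty)
    (hweak : ∀ f : EuclideanSpace ℝ (Fin d) → ℝ, Continuous f → HasCompactSupport f →
      Tendsto (fun n => ∫ x in C n, f x) atTop (nhds (∫ x in D, f x))) :
    Tendsto (fun n => Metric.hausdorffDist (C n) D) atTop (nhds 0) := by
  have hDcl : D ⊆ closure (interior D) := by
    rw [hDconv.closure_interior_eq_closure_of_nonempty_interior hDint]
    exact subset_closure
  have hnear : ∀ {ε : ℝ}, 0 < ε → ∀ᶠ n in atTop, ∀ x ∈ D, ∃ c ∈ C n, dist x c < ε :=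
    fun hε => eventually_forall_exists_mem_dist_lt volume hDcpt hDcl hweak hε
  obtain ⟨x, hx⟩ := hDint
  obtain ⟨r, hr, hxr⟩ := Metric.mem_nhds_iff.1 (mem_interior_iff_mem_nhds.1 hx)
  have hball : ∀ᶠ n in atTop, Metric.ball x (r - r / 2) ⊆ C n := by
    filter_upwards [hnear (half_pos hr)] with n hn
    exact (hCconv n).ball_sub_subset_of_forall_exists_dist_lt (hCcpt n).isClosed
      ((hCint n).mono interior_subset) (half_pos hr) fun y hy => hn y (hxr hy)
  rw [Metric.tendsto_nhds]
  intro ε hε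
  filter_upwards [hnear (half_pos hε), eventually_forall_infDist_le volume hCconv hDcpt hweak
    (interior_subset hx) (by linarith) hball (half_pos hε)] with n h1 h2
  rw [Real.dist_0_eq_abs, abs_of_nonneg Metric.hausdorffDist_nonneg]
  refine lt_of_le_of_lt (Metric.hausdorffDist_le_of_infDist (half_pos hε).le h2 fun y hy => ?_)
    (half_lt_self hε)
  obtain ⟨c, hc, hyc⟩ := h1 y hy
  exact (Metric.infDist_le_dist_of_mem hc).trans hyc.le
end

section
/- Let d ≥ 1, let (C_n)_{n∈ℕ} be a sequence of nonempty compact convex subsets of ℝ^d and let C ⊆ ℝ^d be a nonempty compact convex set. If d_H(C_n, C) → 0 as n → ∞, then the Lebesgue measure of the symmetric difference C_n Δ C = (C_n \ C) ∪ (C \ C_n) tends to 0 as n → ∞. -/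
open MeasureTheory Filter

open Metric Set

open scoped RealInnerProductSpace

theorem exists_mem_frontier_dist_le {E : Type*} [NormedAddCommGroup E] [NormedSpace ℝ E]
    {s : Set E} {x y : E} (h : ¬(x ∈ s ↔ y ∈ s)) :
    ∃ z ∈ frontier s, dist x z ≤ dist x y := by
  obtain ⟨z, hz, hzs⟩ : (segment ℝ x y ∩ frontier s).Nonempty := by
    by_contra hemp
    have hcov : ∀ z ∈ segment ℝ x y, z ∈ interior s ∨ z ∈ (closure s)ᶜ := fun z hz => by
      by_contra! hzs
      exact hemp ⟨z, hz, notMem_compl_iff.1 hzs.2, hzs.1⟩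
    have hmem : ∀ z ∈ segment ℝ x y, (z ∈ s → z ∈ interior s) ∧ (z ∉ s → z ∈ (closure s)ᶜ) :=
      fun z hz => ⟨fun hzs => (hcov z hz).resolve_right fun h => h (subset_closure hzs),
        fun hzs => (hcov z hz).resolve_left fun h => hzs (interior_subset h)⟩
    have hx := hmem x (left_mem_segment ℝ x y)
    have hy := hmem y (right_mem_segment ℝ x y)
    obtain ⟨z, -, hzi, hzc⟩ := (convex_segment x y).isPreconnected (interior s) (closure s)ᶜ
      isOpen_interior isClosed_closure.isOpen_compl hcov
      (by
        by_cases hxs : x ∈ s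
        · exact ⟨x, left_mem_segment ℝ x y, hx.1 hxs⟩
        · exact ⟨y, right_mem_segment ℝ x y, hy.1 (by tauto)⟩)
      (by
        by_cases hxs : x ∈ s
        · exact ⟨y, right_mem_segment ℝ x y, hy.2 (by tauto)⟩
        · exact ⟨x, left_mem_segment ℝ x y, hx.2 hxs⟩)
    exact hzc (interior_subset_closure hzi)
  exact ⟨z, hzs, mem_closedBall'.1 (segment_subset_closedBall_left x y hz)⟩

/-- A point outside a closed convex set can be pushed away from it: moving by `r` in a suitable
direction gives a point at distance at least `r` from the set. -/
theorem Convex.exists_dist_eq_forall_le_dist {E : Type*} [NormedAddCommGroup E]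
    [InnerProductSpace ℝ E] {K : Set E} (hK : Convex ℝ K) (hc : IsComplete K)
    (hne : K.Nonempty) {x : E} (hx : x ∉ K) {r : ℝ} (hr : 0 ≤ r) :
    ∃ y, dist x y = r ∧ ∀ w ∈ K, r ≤ dist y w := by
  obtain ⟨p, hp, hpx⟩ := exists_norm_eq_iInf_of_complete_convex hne hc hK x
  have hin := (norm_eq_iInf_iff_real_inner_le_zero hK hp).1 hpx
  have hpos : 0 < ‖x - p‖ := norm_pos_iff.2 (sub_ne_zero.2 fun h => hx (h ▸ hp))
  refine ⟨x + (r / ‖x - p‖) • (x - p), ?_, fun w hw => ?_⟩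
  · rw [dist_self_add_right, norm_smul, Real.norm_of_nonneg (by positivity),
      div_mul_cancel₀ _ hpos.ne']
  · have h1 := real_inner_le_norm (x - p) (x + (r / ‖x - p‖) • (x - p) - w)
    have h2 : ⟪x - p, x + (r / ‖x - p‖) • (x - p) - w⟫ =
        ‖x - p‖ ^ 2 + r * ‖x - p‖ - ⟪x - p, w - p⟫ := by
      have : x + (r / ‖x - p‖) • (x - p) - w =
          (x - p) + (r / ‖x - p‖) • (x - p) - (w - p) := by abel
      rw [this, inner_sub_right, inner_add_right, inner_smul_right,
        real_inner_self_eq_norm_sq]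
      field_simp
    rw [dist_eq_norm]
    refine le_of_mul_le_mul_left ?_ hpos
    nlinarith [hin w hw, sq_nonneg ‖x - p‖]

theorem symmDiff_subset_cthickening_frontier {E : Type*} [NormedAddCommGroup E]
    [InnerProductSpace ℝ E] {K L : Set E} (hK : Convex ℝ K) (hc : IsComplete K)
    (hne : K.Nonempty) (hfin : hausdorffEDist K L ≠ ⊤) {r : ℝ} (hr : hausdorffDist K L < r) :
    symmDiff K L ⊆ cthickening r (frontier L) := by
  suffices H : ∀ x ∈ symmDiff K L, ∃ y, dist x y ≤ r ∧ ¬(x ∈ L ↔ y ∈ L) by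
    intro x hx
    obtain ⟨y, hxy, hy⟩ := H x hx
    obtain ⟨z, hz, hxz⟩ := exists_mem_frontier_dist_le hy
    exact mem_cthickening_of_dist_le x z r _ hz (hxz.trans hxy)
  rintro x (⟨hxK, hxL⟩ | ⟨hxL, hxK⟩)
  · obtain ⟨y, hy, hxy⟩ := exists_dist_lt_of_hausdorffDist_lt hxK hr hfin
    exact ⟨y, hxy.le, by tauto⟩
  · obtain ⟨y, hxy, hy⟩ :=
      hK.exists_dist_eq_forall_le_dist hc hne hxK (hausdorffDist_nonneg.trans hr.le)
    refine ⟨y, hxy.le, fun h => ?_⟩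
    obtain ⟨w, hw, hwy⟩ := exists_dist_lt_of_hausdorffDist_lt' (h.1 hxL) hr hfin
    exact (hy w hw).not_gt (dist_comm w y ▸ hwy)

/-- **Hausdorff convergence of convex bodies implies convergence in measure of the
symmetric difference.** If `(C n)` is a sequence of nonempty compact convex subsets of
`ℝ^d` converging in Hausdorff distance to a nonempty compact convex set `D`, then the
Lebesgue measure of the symmetric difference `C n Δ D` tends to `0`. -/
theorem hausdorff_tendsto_volume_symmDiff_tendsto (d : ℕ) (hd : 1 ≤ d)
    (C : ℕ → Set (EuclideanSpace ℝ (Fin d))) (D : Set (EuclideanSpace ℝ (Fin d)))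
    (hCcpt : ∀ n, IsCompact (C n)) (hCconv : ∀ n, Convex ℝ (C n))
    (hCne : ∀ n, (C n).Nonempty)
    (hDcpt : IsCompact D) (hDconv : Convex ℝ D) (hDne : D.Nonempty)
    (hH : Tendsto (fun n => Metric.hausdorffDist (C n) D) atTop (nhds 0)) :
    Tendsto (fun n => volume (symmDiff (C n) D)) atTop (nhds 0) := by
  have hF : IsCompact (frontier D) :=
    hDcpt.of_isClosed_subset isClosed_frontier hDcpt.isClosed.frontier_subset
  have hlim := tendsto_measure_cthickening_of_isCompact (μ := volume) hF
  rw [hDconv.addHaar_frontier volume] at hlim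
  have hr : Tendsto (fun n : ℕ => hausdorffDist (C n) D + 1 / ((n : ℝ) + 1)) atTop (nhds 0) := by
    simpa using hH.add tendsto_one_div_add_atTop_nhds_zero_nat
  refine tendsto_of_tendsto_of_tendsto_of_le_of_le tendsto_const_nhds (hlim.comp hr)
    (fun _ => zero_le) fun n => measure_mono ?_
  exact symmDiff_subset_cthickening_frontier (hCconv n) (hCcpt n).isComplete (hCne n)
    (hausdorffEDist_ne_top_of_nonempty_of_bounded (hCne n) hDne (hCcpt n).isBounded
      hDcpt.isBounded)
    (lt_add_of_pos_right _ Nat.one_div_pos_of_nat)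
end
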